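/- For every c ∈ (0,1) there exists ε₀ > 0 such that for every ε ∈ (0, ε₀] there is a Schwartz function χ : ℝ → ℂ whose Fourier transform is a smooth function supported in the interval [ε, 2ε], and which satisfies χ(0) = 1 and Re χ(x) ≥ c for all x ∈ [0,1]. -/

import Mathlib

/-- For every `c ∈ (0,1)` there exists `ε₀ > 0` such that for every
`ε ∈ (0, ε₀]` there is a Schwartz function `χ : ℝ → ℂ` whose Fourier transform is a smooth
function supported in `[ε, 2ε]` (with the convention `χ(x) = ∫ e^{ixξ} χ̂(ξ) dξ`), and which
satisfies `χ(0) = 1` and `Re χ(x) ≥ c` for all `x ∈ [0,1]`. -/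
theorem stmt_0 :
    ∀ c : ℝ, c ∈ Set.Ioo (0 : ℝ) 1 →
      ∃ ε₀ : ℝ, 0 < ε₀ ∧ ∀ ε ∈ Set.Ioc (0 : ℝ) ε₀,
        ∃ χ : SchwartzMap ℝ ℂ,
          (∃ g : ℝ → ℂ, ContDiff ℝ (⊤ : ℕ∞) g ∧ tsupport g ⊆ Set.Icc ε (2 * ε) ∧
            ∀ x : ℝ, χ x = ∫ ξ : ℝ, Complex.exp (Complex.I * ((x * ξ : ℝ) : ℂ)) * g ξ) ∧
          χ 0 = 1 ∧ ∀ x ∈ Set.Icc (0 : ℝ) 1, c ≤ (χ x).re := by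
  intro c hc
  obtain ⟨hc0, hc1⟩ := hc
  refine ⟨(1 - c) / 2, by linarith, ?_⟩
  intro ε hε
  obtain ⟨hε0, hε1⟩ := hε
  let b : ContDiffBump (3 * ε / 2 : ℝ) := ⟨ε / 4, ε / 2, by linarith, by linarith⟩
  let f : ℝ → ℝ := b.normed MeasureTheory.volume
  have hf : ContDiff ℝ (⊤ : ℕ∞) f := b.contDiff_normed
  have hfc : HasCompactSupport f := b.hasCompactSupport_normed
  have hf0 : ∀ x, 0 ≤ f x := fun x => b.nonneg_normed x
  have hf1 : ∫ x, f x = 1 := b.integral_normed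
  have hft : tsupport f = Set.Icc ε (2 * ε) := by
    have h1 := b.tsupport_normed_eq (μ := MeasureTheory.volume)
    have h2 : b.rOut = ε / 2 := rfl
    rw [h2, Real.closedBall_eq_Icc] at h1
    change tsupport f = _ at h1
    rw [h1]
    congr 1 <;> ring
  have hfi : MeasureTheory.Integrable f := b.integrable_normed
  let g : ℝ → ℂ := fun x => (f x : ℂ)
  have hg : ContDiff ℝ (⊤ : ℕ∞) g := Complex.ofRealCLM.contDiff.comp hf
  have hgs : Function.support g = Function.support f := by
    ext x; simp [g]
  have hgt : tsupport g = tsupport f := by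
    simp only [tsupport, hgs]
  have hgc : HasCompactSupport g := by
    unfold HasCompactSupport; rw [hgt]; exact hfc
  have hgi : MeasureTheory.Integrable g := hfi.ofReal
  let G : SchwartzMap ℝ ℂ := hgc.toSchwartzMap hg
  have ha : (2 * Real.pi)⁻¹ ≠ 0 := inv_ne_zero (by positivity)
  let e : ℝ ≃L[ℝ] ℝ := (LinearEquiv.smulOfNeZero ℝ ℝ _ ha).toContinuousLinearEquiv
  let χ : SchwartzMap ℝ ℂ :=
    SchwartzMap.compCLMOfContinuousLinearEquiv ℝ e (FourierTransformInv.fourierInv G)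
  have hχ : ∀ x : ℝ, χ x = ∫ ξ : ℝ, Complex.exp (Complex.I * ((x * ξ : ℝ) : ℂ)) * g ξ := by
    intro x
    have h1 : χ x = FourierTransformInv.fourierInv g ((2 * Real.pi)⁻¹ * x) := by
      change (FourierTransformInv.fourierInv G) (e x) = _
      rw [SchwartzMap.fourierInv_coe]
      rfl
    rw [h1, Real.fourierInv_eq']
    congr 1
    ext ξ
    have hp : (Real.pi : ℂ) ≠ 0 := by exact_mod_cast Real.pi_ne_zero
    simp only [smul_eq_mul]
    congr 2
    simp
    field_simp
  have hre : ∀ x : ℝ, (χ x).re = ∫ ξ : ℝ, Real.cos (x * ξ) * f ξ := by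
    intro x
    have hi : MeasureTheory.Integrable
        (fun ξ : ℝ => Complex.exp (Complex.I * ((x * ξ : ℝ) : ℂ)) * g ξ) := by
      apply Continuous.integrable_of_hasCompactSupport
      · have := hg.continuous
        fun_prop
      · exact hgc.mul_left
    rw [hχ]
    have := integral_re hi
    simp only [RCLike.re_eq_complex_re] at this
    rw [← this]
    congr 1
    ext ξ
    rw [mul_comm Complex.I, Complex.re_mul_ofReal, Complex.exp_ofReal_mul_I_re]
  refine ⟨χ, ⟨g, hg, by rw [hgt, hft], hχ⟩, ?_, ?_⟩
  · rw [hχ]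
    simp only [zero_mul, Complex.ofReal_zero, mul_zero, Complex.exp_zero, one_mul, g]
    rw [integral_complex_ofReal, hf1, Complex.ofReal_one]
  · intro x hx
    obtain ⟨hx0, hx1⟩ := hx
    rw [hre]
    have h1 : c = ∫ ξ, c * f ξ := by
      rw [MeasureTheory.integral_const_mul, hf1, mul_one]
    rw [h1]
    apply MeasureTheory.integral_mono (hfi.const_mul c)
    · apply Continuous.integrable_of_hasCompactSupport
      · have := hf.continuous
        fun_prop
      · exact hfc.mul_left
    · intro ξ
      by_cases hξ : ξ ∈ tsupport f
      · rw [hft] at hξ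
        obtain ⟨h2, h3⟩ := hξ
        apply mul_le_mul_of_nonneg_right _ (hf0 ξ)
        have h4 := Real.one_sub_sq_div_two_le_cos (x := x * ξ)
        have h5 : x * ξ ≤ 1 - c := by nlinarith
        have h6 : 0 ≤ x * ξ := mul_nonneg hx0 (by linarith)
        nlinarith
      · simp [image_eq_zero_of_notMem_tsupport hξ]
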